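/- arXiv:1111.4468 — 3 statements merged into one kernel-verified Lean document; each statement's English description precedes it below -/
import Mathlib

section
/- Let R be a commutative ring containing the polynomial ring ℚ[x₁,...,xₙ] and contained in the Laurent polynomial ring ℚ[x₁^{±1},...,xₙ^{±1}]. Then the Krull dimension of R equals n. -/
open MvPolynomial

lemma eval₂_mem_aux {A R : Type*} [CommRing A] [CommRing R] (φ : A →+* R) (p q : Ideal R)
    [p.IsPrime] (hpq : p ≤ q) (y : R) (hyp : y ∉ p) (hyq : y ∈ q)
    (h : ∀ a, φ a ∈ q → a = 0) (d : ℕ) :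
    ∀ g : Polynomial A, g.natDegree ≤ d → g.eval₂ φ y ∈ p → g = 0 := by
  induction d with
  | zero =>
    intro g hg hm
    rw [Polynomial.eq_C_of_natDegree_le_zero hg] at hm ⊢
    rw [Polynomial.eval₂_C] at hm
    rw [h _ (hpq hm), Polynomial.C_0]
  | succ d ih =>
    intro g hg hm
    have e := Polynomial.divX_mul_X_add g
    rw [← e, Polynomial.eval₂_add, Polynomial.eval₂_mul, Polynomial.eval₂_X,
      Polynomial.eval₂_C] at hm
    have h0 : g.coeff 0 = 0 := by
      apply h
      have := hpq hm
      rwa [Ideal.add_mem_iff_right _ (Ideal.mul_mem_left _ _ hyq)] at this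
    rw [h0, map_zero, add_zero] at hm
    have h1 := (Ideal.IsPrime.mem_or_mem ‹_› hm).resolve_right hyp
    have h2 := ih g.divX (by rw [Polynomial.natDegree_divX_eq_natDegree_tsub_one]; omega) h1
    rw [← e, h2, h0]; simp

lemma exists_algInd_of_chain {k R : Type*} [CommRing k] [CommRing R] [Algebra k R]
    (m : ℕ) : ∀ (p : Fin (m + 1) → PrimeSpectrum R), StrictMono p →
    (∀ a : k, algebraMap k R a ∈ (p (Fin.last m)).asIdeal → a = 0) →
    ∃ x : Fin m → R, ∀ f : MvPolynomial (Fin m) k,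
      aeval x f ∈ (p 0).asIdeal → f = 0 := by
  induction m with
  | zero =>
    intro p hp hk
    refine ⟨Fin.elim0, fun f hf => ?_⟩
    rw [MvPolynomial.eq_C_of_isEmpty f] at hf ⊢
    rw [aeval_C] at hf
    rw [hk _ hf, C_0]
  | succ m ih =>
    intro p hp hk
    obtain ⟨x, hx⟩ := ih (fun i => p i.succ) (fun i j hij => hp (Fin.succ_lt_succ_iff.2 hij))
      (by simpa using hk)
    have hlt : p 0 < p (Fin.succ 0) := hp (Fin.succ_pos 0)
    have hle : (p 0).asIdeal < (p (Fin.succ 0)).asIdeal := hlt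
    obtain ⟨y, hyq, hyp⟩ := SetLike.exists_of_lt hle
    refine ⟨Fin.cons y x, fun f hf => ?_⟩
    have e : aeval (Fin.cons y x : Fin (m + 1) → R) f =
        (finSuccEquiv k m f).eval₂ (aeval x : MvPolynomial (Fin m) k →ₐ[k] R).toRingHom y := by
      clear hf
      induction f using MvPolynomial.induction_on with
      | C a => simp [finSuccEquiv_apply]
      | add f g hf hg => rw [map_add, map_add, Polynomial.eval₂_add, hf, hg]
      | mul_X f i hf =>
        rw [map_mul, map_mul, Polynomial.eval₂_mul, hf]
        congr 1
        refine Fin.cases ?_ (fun j => ?_) i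
        · simp [finSuccEquiv_X_zero]
        · simp [finSuccEquiv_X_succ]
    rw [e] at hf
    have := eval₂_mem_aux _ (p 0).asIdeal _ hle.le y hyp hyq hx _ _ le_rfl hf
    simpa using this

lemma krullDim_le_aux (n : ℕ)
    (R : Subring (FractionRing (MvPolynomial (Fin n) ℚ)))
    (hlow : ((algebraMap (MvPolynomial (Fin n) ℚ)
        (FractionRing (MvPolynomial (Fin n) ℚ))).range : Subring _) ≤ R) :
    ringKrullDim R ≤ n := by
  let _ : Algebra ℚ R := (((algebraMap (MvPolynomial (Fin n) ℚ)
        (FractionRing (MvPolynomial (Fin n) ℚ))).codRestrict R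
          (fun a => hlow ⟨a, rfl⟩)).comp C).toAlgebra
  refine iSup_le fun s => ?_
  obtain ⟨x, hx⟩ := exists_algInd_of_chain (k := ℚ) s.length s s.strictMono (by
    intro a ha
    by_contra h
    exact (s (Fin.last _)).2.ne_top (Ideal.eq_top_of_isUnit_mem _ ha ((IsUnit.mk0 a h).map _)))
  have hi : AlgebraicIndependent ℚ x := by
    rw [algebraicIndependent_iff]
    intro f hf
    exact hx f (by rw [hf]; exact zero_mem _)
  have hi2 := hi.map' (f := (R.subtype.toRatAlgHom)) (Subtype.val_injective)
  have h1 := hi2.lift_cardinalMk_le_trdeg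
  have h2 := _root_.trdeg_add_eq ℚ (MvPolynomial (Fin n) ℚ)
    (A := FractionRing (MvPolynomial (Fin n) ℚ))
  have h3 : Algebra.IsAlgebraic (MvPolynomial (Fin n) ℚ) (FractionRing (MvPolynomial (Fin n) ℚ)) :=
    IsLocalization.isAlgebraic _ (nonZeroDivisors (MvPolynomial (Fin n) ℚ))
  rw [MvPolynomial.trdeg_of_isDomain, _root_.trdeg_eq_zero] at h2
  rw [← h2] at h1
  simp at h1
  exact_mod_cast h1

noncomputable def subst (n k : ℕ) : MvPolynomial (Fin n) ℚ →ₐ[ℚ] MvPolynomial (Fin n) ℚ :=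
  aeval (fun i => if i.1 < k then 1 else X i)

lemma subst_comp (n k : ℕ) (a : MvPolynomial (Fin n) ℚ) :
    subst n (k + 1) (subst n k a) = subst n (k + 1) a := by
  have : (subst n (k + 1)).comp (subst n k) = subst n (k + 1) := by
    ext1 i
    simp only [subst, AlgHom.comp_apply, aeval_X]
    split_ifs <;> first | omega | simp_all
  exact DFunLike.congr_fun this a

noncomputable def ev (n : ℕ) : MvPolynomial (Fin n) ℚ →ₐ[ℚ] ℚ := aeval (fun _ => 1)

lemma ev_subst (n k : ℕ) (a : MvPolynomial (Fin n) ℚ) :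
    ev n (subst n k a) = ev n a := by
  have : (ev n).comp (subst n k) = ev n := by
    ext1 i
    simp only [subst, ev, AlgHom.comp_apply, aeval_X]
    split_ifs <;> simp
  exact DFunLike.congr_fun this a

noncomputable def evM (n : ℕ) : Submonoid (MvPolynomial (Fin n) ℚ) where
  carrier := {a | ev n a ≠ 0}
  mul_mem' := fun {a b} ha hb => by
    change ev n (a * b) ≠ 0
    rw [map_mul]
    exact mul_ne_zero ha hb
  one_mem' := by
    change ev n 1 ≠ 0
    rw [map_one]
    exact one_ne_zero

lemma mem_evM (n : ℕ) (a : MvPolynomial (Fin n) ℚ) : a ∈ evM n ↔ ev n a ≠ 0 := Iff.rfl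

lemma evM_le (n : ℕ) : evM n ≤ nonZeroDivisors _ := by
  intro a ha
  rw [mem_nonZeroDivisors_iff_ne_zero]
  rintro rfl
  exact ha (map_zero _)

noncomputable abbrev SS (n : ℕ) : Subalgebra (MvPolynomial (Fin n) ℚ)
    (FractionRing (MvPolynomial (Fin n) ℚ)) :=
  Localization.subalgebra.ofField _ (evM n) (evM_le n)

noncomputable def psi (n k : ℕ) : SS n →+* FractionRing (MvPolynomial (Fin n) ℚ) :=
  IsLocalization.lift (M := evM n)
    (g := (algebraMap _ (FractionRing (MvPolynomial (Fin n) ℚ))).comp (subst n k).toRingHom) (by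
    rintro ⟨s, hs⟩
    refine IsUnit.mk0 _ ?_
    intro h
    have h' : algebraMap _ (FractionRing (MvPolynomial (Fin n) ℚ)) (subst n k s) = 0 := h
    rw [map_eq_zero_iff _ (IsFractionRing.injective _ _)] at h'
    apply hs
    change ev n s = 0
    rw [← ev_subst n k, h', map_zero])

lemma psi_alg (n k : ℕ) (a : MvPolynomial (Fin n) ℚ) :
    psi n k (algebraMap _ _ a) = algebraMap _ _ (subst n k a) :=
  IsLocalization.lift_eq _ _

lemma psi_mono (n k : ℕ) (r : SS n) (h : psi n k r = 0) : psi n (k + 1) r = 0 := by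
  obtain ⟨⟨a, s⟩, hs⟩ := IsLocalization.surj (evM n) r
  have h1 := congrArg (psi n k) hs
  have h2 := congrArg (psi n (k + 1)) hs
  simp only [map_mul, psi_alg] at h1 h2
  rw [h, zero_mul, eq_comm, map_eq_zero_iff _ (IsFractionRing.injective _ _)] at h1
  rw [← subst_comp n k a, h1, map_zero, map_zero] at h2
  refine (mul_eq_zero.1 h2).resolve_right ?_
  intro h3
  rw [map_eq_zero_iff _ (IsFractionRing.injective _ _)] at h3
  apply s.2
  change ev n s = 0
  rw [← ev_subst n (k + 1), h3, map_zero]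

lemma le_krullDim_aux (n : ℕ)
    (R : Subring (FractionRing (MvPolynomial (Fin n) ℚ)))
    (hlow : ((algebraMap (MvPolynomial (Fin n) ℚ)
        (FractionRing (MvPolynomial (Fin n) ℚ))).range : Subring _) ≤ R)
    (hR : R ≤ (SS n).toSubring) : n ≤ ringKrullDim R := by
  let i : R →+* SS n := Subring.inclusion hR
  let P : Fin (n + 1) → PrimeSpectrum R := fun k =>
    ⟨RingHom.ker ((psi n k).comp i), RingHom.ker_isPrime _⟩
  have hP : StrictMono P := by
    rw [Fin.strictMono_iff_lt_succ]
    intro k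
    change RingHom.ker ((psi n k).comp i) < RingHom.ker ((psi n (k + 1)).comp i)
    refine SetLike.lt_iff_le_and_exists.2 ⟨fun r hr => psi_mono n k _ hr, ?_⟩
    have hx : ∀ j, psi n j (i ⟨_, hlow ⟨X k - 1, rfl⟩⟩) =
      algebraMap _ _ (subst n j (X k - 1)) := fun j => psi_alg n j (X k - 1)
    refine ⟨⟨_, hlow ⟨X k - 1, rfl⟩⟩, ?_, ?_⟩
    · rw [RingHom.mem_ker, RingHom.comp_apply, hx]
      simp [subst]
    · rw [RingHom.mem_ker, RingHom.comp_apply, hx,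
        map_eq_zero_iff _ (IsFractionRing.injective _ _)]
      simp only [subst, map_sub, aeval_X, map_one, lt_irrefl, if_false]
      intro h
      have := congrArg (aeval (fun _ => (0 : ℚ))) h
      simp at this
  exact Order.LTSeries.length_le_krullDim (LTSeries.mk n P hP)

/-- Any commutative ring `R` with
`ℚ[x₁,…,xₙ] ⊆ R ⊆ ℚ[x₁^{±1},…,xₙ^{±1}]` (realized as subrings of the fraction
field of the polynomial ring) has Krull dimension `n`. -/
theorem krullDim_of_between_polynomial_and_laurent (n : ℕ)
    (R : Subring (FractionRing (MvPolynomial (Fin n) ℚ)))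
    (hlow : ((algebraMap (MvPolynomial (Fin n) ℚ)
        (FractionRing (MvPolynomial (Fin n) ℚ))).range : Subring _) ≤ R)
    (hhigh : R ≤ Subring.closure
      (((algebraMap (MvPolynomial (Fin n) ℚ)
          (FractionRing (MvPolynomial (Fin n) ℚ))).range : Set _) ∪
        {y | ∃ i : Fin n,
          y = (algebraMap (MvPolynomial (Fin n) ℚ)
                (FractionRing (MvPolynomial (Fin n) ℚ)) (X i))⁻¹})) :
    ringKrullDim R = n := by
  refine le_antisymm (krullDim_le_aux n R hlow) (le_krullDim_aux n R hlow (hhigh.trans ?_))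
  rw [Subring.closure_le]
  rintro y (⟨a, rfl⟩ | ⟨i, rfl⟩)
  · exact (SS n).algebraMap_mem a
  · refine ⟨1, X i, ?_, by simp⟩
    rw [mem_evM]
    simp [ev]
end

section
/- Let R be a commutative ring, let a₁,...,aₘ, b₁,...,bₘ, c₁,...,cₖ be indeterminates, and consider S = R[a₁,...,aₘ, c₁^{±1},...,cₖ^{±1}, b₁,...,bₘ]. For each i, let πᵢ⁺ and πᵢ⁻ be monomials in the variables other than b₁,...,bₘ. Then the sequence (a₁b₁ − π₁⁺ − π₁⁻, ..., aₘbₘ − πₘ⁺ − πₘ⁻) is a regular sequence in S. -/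
set_option synthInstance.maxHeartbeats 1000000

noncomputable section

open MvPolynomial

/-- The ring `T = R[a₁,…,aₘ, c₁^{±1},…,c_k^{±1}]`: the localization of the polynomial
ring `R[a₁,…,aₘ,c₁,…,c_k]` at the multiplicative set generated by the `c`'s. -/
abbrev LaurentBase (R : Type*) [CommRing R] (m k : ℕ) :=
  Localization (Submonoid.closure
    (Set.range fun j : Fin k => (X (Sum.inr j) : MvPolynomial (Fin m ⊕ Fin k) R)))

/-- The multiplicative monoid of monomials in the variables `a₁,…,aₘ,c₁^{±1},…,c_k^{±1}`
(i.e. in all the variables except the `b`'s), inside `LaurentBase R m k`. -/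
def laurentMonomials (R : Type*) [CommRing R] (m k : ℕ) :
    Submonoid (LaurentBase R m k) :=
  Submonoid.closure
    ((Set.range fun v : Fin m ⊕ Fin k =>
        algebraMap (MvPolynomial (Fin m ⊕ Fin k) R) (LaurentBase R m k) (X v)) ∪
      {y | ∃ j : Fin k,
        y * algebraMap (MvPolynomial (Fin m ⊕ Fin k) R) (LaurentBase R m k)
              (X (Sum.inr j)) = 1})

theorem aux_poly {U : Type*} [CommRing U] (J : Ideal U) (a p : U)
    (ha : ∀ x, a * x ∈ J → x ∈ J) (f : Polynomial U)
    (hf : (Polynomial.C a * Polynomial.X - Polynomial.C p) * f ∈ J.map Polynomial.C) :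
    f ∈ J.map Polynomial.C := by
  rw [Ideal.mem_map_C_iff] at hf ⊢
  have step : ∀ n, f.coeff (n + 1) ∈ J → f.coeff n ∈ J := by
    intro n hn
    apply ha
    have h := hf (n + 1)
    rw [sub_mul, mul_assoc, Polynomial.coeff_sub, Polynomial.coeff_C_mul, Polynomial.coeff_C_mul,
      Polynomial.coeff_X_mul] at h
    have h2 := J.add_mem h (J.mul_mem_left p hn)
    simpa using h2
  have key : ∀ d n, f.natDegree < n + d → f.coeff n ∈ J := by
    intro d
    induction d with
    | zero =>
      intro n hn
      rw [Polynomial.coeff_eq_zero_of_natDegree_lt (by simpa using hn)]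
      exact J.zero_mem
    | succ d ih =>
      intro n hn
      exact step n (ih (n + 1) (by omega))
  intro n
  exact key (f.natDegree + 1) n (by omega)

section Aux

variable {T : Type*} [CommRing T] {m : ℕ} (a p : Fin m → T)

def auxR (i : Fin m) : MvPolynomial (Fin m) T := C (a i) * X i - C (p i)

def auxJ (I : Set (Fin m)) (n : ℕ) : Ideal (MvPolynomial (Fin m) T) :=
  Ideal.span ((fun i => C (a i)) '' I ∪ auxR a p '' {j | j.val < n})

theorem auxJ_insert (I : Set (Fin m)) (n : ℕ) (i : Fin m) :
    auxJ a p (insert i I) n = Ideal.span {C (a i)} ⊔ auxJ a p I n := by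
  rw [auxJ, auxJ, ← Ideal.span_union, Set.image_insert_eq, Set.insert_union, Set.singleton_union]

theorem auxJ_succ (I : Set (Fin m)) (n : ℕ) (hn : n < m) :
    auxJ a p I (n + 1) = Ideal.span {auxR a p ⟨n, hn⟩} ⊔ auxJ a p I n := by
  rw [auxJ, auxJ, ← Ideal.span_union]
  have : {j : Fin m | j.val < n + 1} = insert ⟨n, hn⟩ {j : Fin m | j.val < n} := by
    ext j
    simp [Fin.ext_iff]
    omega
  rw [this, Set.image_insert_eq, Set.union_insert, Set.singleton_union]

theorem aux_B (I : Set (Fin m)) (n : ℕ) (hn : n < m)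
    (hA : ∀ f, C (a ⟨n, hn⟩) * f ∈ auxJ a p I n → f ∈ auxJ a p I n)
    (f : MvPolynomial (Fin m) T) (hf : auxR a p ⟨n, hn⟩ * f ∈ auxJ a p I n) :
    f ∈ auxJ a p I n := by
  classical
  let φ : MvPolynomial (Fin m) T →+* Polynomial (MvPolynomial (Fin m) T) :=
    eval₂Hom (Polynomial.C.comp C)
      (fun j => if j = ⟨n, hn⟩ then Polynomial.X else Polynomial.C (X j))
  have hφC : ∀ t, φ (C t) = Polynomial.C (C t) := fun t => by simp [φ]
  have hφX : φ (X ⟨n, hn⟩) = Polynomial.X := by simp [φ]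
  have hψ : (Polynomial.evalRingHom (X ⟨n, hn⟩)).comp φ = RingHom.id _ := by
    apply MvPolynomial.ringHom_ext
    · intro t; simp [φ]
    · intro j
      by_cases hj : j = ⟨n, hn⟩ <;> simp [φ, hj]
  have hle : auxJ a p I n ≤ ((auxJ a p I n).map Polynomial.C).comap φ := by
    conv_lhs => rw [auxJ]
    rw [Ideal.span_le]
    rintro g hg
    have hgJ : g ∈ auxJ a p I n := Ideal.subset_span hg
    have : φ g = Polynomial.C g := by
      rcases hg with ⟨i, -, rfl⟩ | ⟨j, hj, rfl⟩
      · exact hφC _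
      · have hne : j ≠ ⟨n, hn⟩ := by
          rintro rfl
          simp at hj
        simp [auxR, φ, hne]
    change φ g ∈ (auxJ a p I n).map Polynomial.C
    rw [this]
    exact Ideal.mem_map_of_mem _ hgJ
  have h1 : φ (auxR a p ⟨n, hn⟩ * f) ∈ (auxJ a p I n).map Polynomial.C := hle hf
  rw [map_mul, auxR, map_sub, map_mul, hφC, hφC, hφX] at h1
  have h2 := aux_poly _ _ _ hA _ h1
  have h3 := Ideal.mem_map_of_mem (Polynomial.evalRingHom (X ⟨n, hn⟩)) h2
  rw [Ideal.map_map] at h3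
  have h4 : (Polynomial.evalRingHom (X ⟨n, hn⟩)).comp (Polynomial.C) =
      RingHom.id (MvPolynomial (Fin m) T) := by
    ext <;> simp
  rw [h4, Ideal.map_id, ← RingHom.comp_apply, hψ] at h3
  exact h3

theorem aux_A (h0 : ∀ (I : Set (Fin m)) (i : Fin m), i ∉ I → ∀ x : T,
      a i * x ∈ Ideal.span (a '' I) → x ∈ Ideal.span (a '' I)) (n : ℕ) (hn : n ≤ m) :
    ∀ (I : Set (Fin m)), (∀ j ∈ I, n ≤ j.val) → ∀ i : Fin m, i ∉ I → n ≤ i.val →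
      ∀ f, C (a i) * f ∈ auxJ a p I n → f ∈ auxJ a p I n := by
  induction n with
  | zero =>
    intro I _ i hi _ f hf
    have : auxJ a p I 0 = (Ideal.span (a '' I)).map C := by
      rw [auxJ, Ideal.map_span, Set.image_image]
      simp
    rw [this, MvPolynomial.mem_map_C_iff] at hf ⊢
    intro d
    apply h0 I i hi
    simpa using hf d
  | succ n ih =>
    intro I hI i hi hni f hf
    have ih := ih (by omega)
    rw [auxJ_succ a p I n hn, Ideal.mem_span_singleton_sup] at hf
    obtain ⟨g, j, hj, e⟩ := hf
    have hg : g ∈ auxJ a p (insert i I) n := by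
      apply aux_B a p (insert i I) n hn
      · apply ih
        · rintro j (rfl | hj)
          · omega
          · have := hI j hj
            omega
        · rintro (h | h)
          · rw [← h] at hni
            simp at hni
          · have := hI _ h
            simp at this
        · simp
      · rw [auxJ_insert, Ideal.mem_span_singleton_sup]
        exact ⟨f, -j, neg_mem hj, by rw [mul_comm f, ← e]; ring⟩
    rw [auxJ_insert, Ideal.mem_span_singleton_sup] at hg
    obtain ⟨h, j', hj', e'⟩ := hg
    have : f - auxR a p ⟨n, hn⟩ * h ∈ auxJ a p I n := by
      apply ih I (fun j hj => by have := hI j hj; omega) i hi (by omega)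
      have : C (a i) * (f - auxR a p ⟨n, hn⟩ * h) = j + auxR a p ⟨n, hn⟩ * j' := by
        rw [mul_sub, ← e, ← e']; ring
      rw [this]
      exact add_mem hj (Ideal.mul_mem_left _ _ hj')
    rw [auxJ_succ a p I n hn, Ideal.mem_span_singleton_sup]
    exact ⟨h, _, this, by ring⟩

theorem aux_main (h0 : ∀ (I : Set (Fin m)) (i : Fin m), i ∉ I → ∀ x : T,
      a i * x ∈ Ideal.span (a '' I) → x ∈ Ideal.span (a '' I)) :
    RingTheory.Sequence.IsWeaklyRegular (MvPolynomial (Fin m) T) (List.ofFn (auxR a p)) := by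
  constructor
  intro i h
  rw [isSMulRegular_quotient_iff_mem_of_smul_mem]
  have hi : i < m := by simpa using h
  have e : (Ideal.ofList (List.take i (List.ofFn (auxR a p))) • ⊤ :
      Ideal (MvPolynomial (Fin m) T)) = auxJ a p ∅ i := by
    rw [smul_eq_mul, Ideal.mul_top, Ideal.ofList, auxJ]
    congr 1
    ext x
    simp only [Set.mem_setOf_eq, List.mem_take_iff_getElem, Set.image_empty, Set.empty_union,
      Set.mem_image]
    constructor
    · rintro ⟨j, hj, rfl⟩
      simp at hj
      exact ⟨⟨j, by omega⟩, by simp; omega, by simp⟩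
    · rintro ⟨j, hj, rfl⟩
      exact ⟨j.val, by simp; omega, by simp⟩
  rw [e]
  intro x hx
  rw [List.getElem_ofFn, smul_eq_mul] at hx
  exact aux_B a p ∅ i hi (aux_A a p h0 i hi.le ∅ (by simp) _ (by simp) (by simp)) x hx

end Aux

theorem aux_X {σ R : Type*} [CommRing R] (s : Set σ) (i : σ) (hi : i ∉ s) (y : MvPolynomial σ R)
    (h : X i * y ∈ Ideal.span (X '' s : Set (MvPolynomial σ R))) :
    y ∈ Ideal.span (X '' s : Set (MvPolynomial σ R)) := by
  classical
  rw [mem_ideal_span_X_image] at h ⊢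
  intro d hd
  obtain ⟨j, hj, hne⟩ := h (Finsupp.single i 1 + d) (by
    rw [support_X_mul]
    exact Finset.mem_map_of_mem _ hd)
  refine ⟨j, hj, ?_⟩
  have : i ≠ j := fun e => hi (e ▸ hj)
  simpa [Finsupp.single_apply, this] using hne

theorem aux_loc {A B : Type*} [CommRing A] [CommRing B] [Algebra A B] (M : Submonoid A)
    [IsLocalization M B] (I : Ideal A) (c : A) (hc : ∀ y, c * y ∈ I → y ∈ I) (x : B)
    (hx : algebraMap A B c * x ∈ I.map (algebraMap A B)) : x ∈ I.map (algebraMap A B) := by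
  obtain ⟨y, s, rfl⟩ := IsLocalization.exists_mk'_eq M x
  rw [IsLocalization.mul_mk'_eq_mk'_of_mul, IsLocalization.mk'_mem_map_algebraMap_iff] at hx
  rw [IsLocalization.mk'_mem_map_algebraMap_iff]
  obtain ⟨t, ht, h⟩ := hx
  exact ⟨t, ht, hc _ (by rwa [mul_left_comm])⟩

/-- In `S = R[a₁,…,aₘ, c₁^{±1},…,c_k^{±1}, b₁,…,bₘ]`, if each
`πᵢ⁺, πᵢ⁻` is a monomial in the variables other than the `b`'s, then the sequence
`(a₁b₁ − π₁⁺ − π₁⁻, …, aₘbₘ − πₘ⁺ − πₘ⁻)` is a regular sequence in `S`. -/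
theorem exchange_relations_isRegular (R : Type*) [CommRing R] [Nontrivial R]
    (m k : ℕ) (pp pm : Fin m → LaurentBase R m k)
    (hp : ∀ i, pp i ∈ laurentMonomials R m k)
    (hm : ∀ i, pm i ∈ laurentMonomials R m k) :
    RingTheory.Sequence.IsRegular (MvPolynomial (Fin m) (LaurentBase R m k))
      (List.ofFn fun i : Fin m =>
        (C (algebraMap (MvPolynomial (Fin m ⊕ Fin k) R) (LaurentBase R m k)
              (X (Sum.inl i))) * X i
          - C (pp i) - C (pm i) : MvPolynomial (Fin m) (LaurentBase R m k))) := by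
  have e : (fun i : Fin m =>
        (C (algebraMap (MvPolynomial (Fin m ⊕ Fin k) R) (LaurentBase R m k)
              (X (Sum.inl i))) * X i
          - C (pp i) - C (pm i) : MvPolynomial (Fin m) (LaurentBase R m k))) =
      auxR (fun i => algebraMap (MvPolynomial (Fin m ⊕ Fin k) R) (LaurentBase R m k)
              (X (Sum.inl i))) (fun i => pp i + pm i) := by
    funext i
    rw [auxR, C_add, sub_sub]
  rw [e]
  constructor
  · apply aux_main
    intro I i hi x hx
    have e2 : Ideal.span ((fun i => algebraMap (MvPolynomial (Fin m ⊕ Fin k) R)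
        (LaurentBase R m k) (X (Sum.inl i))) '' I) =
        (Ideal.span (X '' (Sum.inl '' I))).map (algebraMap (MvPolynomial (Fin m ⊕ Fin k) R)
        (LaurentBase R m k)) := by
      rw [Ideal.map_span, Set.image_image, Set.image_image]
    rw [e2] at hx ⊢
    refine aux_loc (Submonoid.closure
      (Set.range fun j : Fin k => (X (Sum.inr j) : MvPolynomial (Fin m ⊕ Fin k) R))) _ _ ?_ x hx
    intro y hy
    exact aux_X _ _ (by simpa using hi) y hy
  · have hu : ∀ y : Submonoid.closure
        (Set.range fun j : Fin k => (X (Sum.inr j) : MvPolynomial (Fin m ⊕ Fin k) R)),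
        IsUnit (eval (fun _ => (1 : R)) (y : MvPolynomial (Fin m ⊕ Fin k) R)) := by
      rintro ⟨y, hy⟩
      have : Submonoid.closure
        (Set.range fun j : Fin k => (X (Sum.inr j) : MvPolynomial (Fin m ⊕ Fin k) R)) ≤
        (IsUnit.submonoid R).comap (eval (fun _ => (1 : R))) := by
        rw [Submonoid.closure_le]
        rintro _ ⟨j, rfl⟩
        simp [IsUnit.mem_submonoid_iff]
      exact this hy
    let θ : LaurentBase R m k →+* R := IsLocalization.lift hu
    let Θ : MvPolynomial (Fin m) (LaurentBase R m k) →+* R :=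
      eval₂Hom θ (fun i => θ (pp i + pm i))
    intro htop
    rw [smul_eq_mul, Ideal.mul_top] at htop
    have hle : Ideal.ofList (List.ofFn (auxR (fun i => algebraMap (MvPolynomial (Fin m ⊕ Fin k) R)
        (LaurentBase R m k) (X (Sum.inl i))) (fun i => pp i + pm i))) ≤ RingHom.ker Θ := by
      rw [Ideal.ofList, Ideal.span_le]
      intro x hx
      simp only [Set.mem_setOf_eq, List.mem_ofFn] at hx
      obtain ⟨i, rfl⟩ := hx
      have : θ (algebraMap (MvPolynomial (Fin m ⊕ Fin k) R)
        (LaurentBase R m k) (X (Sum.inl i))) = 1 := by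
        simp only [θ]
        rw [IsLocalization.lift_eq]
        simp
      change Θ _ = 0
      simp only [Θ, auxR, map_sub, map_mul, coe_eval₂Hom, eval₂_C, eval₂_X, this]
      simp
    rw [← htop] at hle
    exact RingHom.ker_ne_top Θ (top_le_iff.mp hle)
end
end

section
/- Let A be a commutative ring and s₁,...,sₖ elements generating the unit ideal such that each localization A[sᵢ⁻¹] is a finitely generated ℤ-algebra. Then A is a finitely generated ℤ-algebra. -/
/-- If `s₁,…,s_k` generate the unit ideal of a commutative ring `A`
and each localization `A[sᵢ⁻¹]` is a finitely generated `ℤ`-algebra, then `A` is a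
finitely generated `ℤ`-algebra. -/
theorem finiteType_of_finiteType_localizations {A : Type*} [CommRing A]
    {k : ℕ} (s : Fin k → A) (hs : Ideal.span (Set.range s) = ⊤)
    (hloc : ∀ i, Algebra.FiniteType ℤ (Localization.Away (s i))) :
    Algebra.FiniteType ℤ A := by
  apply Algebra.FiniteType.of_span_eq_top_target (Set.range s) hs
  rintro _ ⟨i, rfl⟩
  convert hloc i using 1
end
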